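/- arXiv:1902.01166 — 2 statements merged into one kernel-verified Lean document; each statement's English description precedes it below -/
import Mathlib

section
/- For all integers k, j ≥ 1 with k ≠ j, the polynomials ψ_k and ψ_j are orthogonal in L²(0,1): ∫₀¹ ψ_k(x)·ψ_j(x) dx = 0. -/
open Polynomial

/-- The Jacobi-type polynomial sequence: G 1 = 1, G 2 = X - 1/2, and for k ≥ 3,
    G k = (X - 1/2)·G (k-1) - ((k-2)(k+2)/(4(2k-1)(2k+1)))·G (k-2). -/
noncomputable def G : ℕ → Polynomial ℝ
  | 0 => 0
  | 1 => 1
  | 2 => Polynomial.X - Polynomial.C (1/2)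
  | (k+3) =>
      (Polynomial.X - Polynomial.C (1/2)) * G (k+2)
        - Polynomial.C ((((k:ℝ)+1)*((k:ℝ)+5))/(4*(2*(k:ℝ)+5)*(2*(k:ℝ)+7))) * G (k+1)

/-- ψ_k = ((2k+2)!/((k−1)!·(k+1)!))·X(1−X)·G_k. -/
noncomputable def psi (k : ℕ) : Polynomial ℝ :=
  Polynomial.C ((Nat.factorial (2*k+2) : ℝ) /
      ((Nat.factorial (k-1) : ℝ) * (Nat.factorial (k+1) : ℝ)))
    * (Polynomial.X * (1 - Polynomial.X)) * G k

noncomputable def gb (k : ℕ) : ℝ := (((k:ℝ)+1)*((k:ℝ)+5))/(4*(2*(k:ℝ)+5)*(2*(k:ℝ)+7))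

lemma g_rec (k : ℕ) (x : ℝ) :
    (G (k+3)).eval x = (x - 1/2) * (G (k+2)).eval x - gb k * (G (k+1)).eval x := by
  rw [G]; simp [gb]

lemma dg_rec (k : ℕ) (x : ℝ) :
    (derivative (G (k+3))).eval x = (G (k+2)).eval x
      + (x - 1/2) * (derivative (G (k+2))).eval x - gb k * (derivative (G (k+1))).eval x := by
  rw [G]; simp [gb]

lemma gb_rel (k : ℕ) : 1/4 + gb k * (2*k+5) = (2*k+9) * gb (k+1) := by
  have h1 : (2*(k:ℝ)+5) ≠ 0 := by positivity
  have h2 : (2*(k:ℝ)+7) ≠ 0 := by positivity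
  have h3 : (2*(k:ℝ)+9) ≠ 0 := by positivity
  have e1 : gb (k+1) = (((k:ℝ)+2)*((k:ℝ)+6))/(4*(2*(k:ℝ)+7)*(2*(k:ℝ)+9)) := by
    unfold gb; push_cast; ring_nf
  rw [e1, gb]
  field_simp
  ring

lemma struct (k : ℕ) (x : ℝ) :
    x*(1-x) * (derivative (G (k+1))).eval x
      = (k+5) * (x-1/2) * (G (k+1)).eval x - (2*k+5) * (G (k+2)).eval x := by
  induction k using Nat.strong_induction_on with
  | _ k ih =>
    match k, ih with
    | 0, _ => simp [G]
    | 1, _ =>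
      have h := g_rec 0 x
      norm_num [gb] at h
      norm_num
      rw [h]
      simp [G]; ring
    | k+2, ih =>
      have h0 := ih k (by omega)
      have h1 := ih (k+1) (by omega)
      have r0 := g_rec k x
      have r1 := g_rec (k+1) x
      have d := dg_rec k x
      have c := gb_rel k
      simp only [add_assoc, Nat.reduceAdd] at h0 h1 r0 r1 d ⊢
      push_cast at h1 ⊢
      rw [d, r1]
      linear_combination (x-1/2) * h1 - gb k * h0 + (G (k+2)).eval x * c
        - (k+5) * (x-1/2) * r0

noncomputable def LL (p : ℝ[X]) : ℝ := ∫ x in (0:ℝ)..1, (x*(1-x))^2 * p.eval x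

lemma LL_int (p : ℝ[X]) :
    IntervalIntegrable (fun x : ℝ => (x*(1-x))^2 * p.eval x) MeasureTheory.volume 0 1 := by
  apply Continuous.intervalIntegrable
  fun_prop

lemma LL_sub (p q : ℝ[X]) : LL (p - q) = LL p - LL q := by
  unfold LL
  rw [← intervalIntegral.integral_sub (LL_int p) (LL_int q)]
  congr 1; ext x; simp; ring

lemma LL_C (c : ℝ) (p : ℝ[X]) : LL (C c * p) = c * LL p := by
  unfold LL
  rw [← intervalIntegral.integral_const_mul]
  congr 1; ext x; simp; ring

lemma LL_struct (k : ℕ) :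
    ((k:ℝ)-1) * LL ((X - C (1/2)) * G (k+1)) = (2*k+5) * LL (G (k+2)) := by
  have h : LL (C ((k:ℝ)-1) * ((X - C (1/2)) * G (k+1)) - C (2*(k:ℝ)+5) * G (k+2)) = 0 := by
    unfold LL
    have key : ∀ x ∈ Set.uIcc (0:ℝ) 1,
        HasDerivAt (fun x : ℝ => ((X*(1-X))^3 * G (k+1)).eval x)
        ((x*(1-x))^2 * (C ((k:ℝ)-1) * ((X - C (1/2)) * G (k+1))
          - C (2*(k:ℝ)+5) * G (k+2)).eval x) x := by
      intro x _
      have hd := ((X*(1-X))^3 * G (k+1)).hasDerivAt x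
      refine hd.congr_deriv ?_
      have s := struct k x
      simp [derivative_pow]
      linear_combination ((x*(1-x))^2) * s
    rw [intervalIntegral.integral_eq_sub_of_hasDerivAt key (LL_int _)]
    simp
  rw [LL_sub, LL_C, LL_C] at h
  linarith

lemma G_rec (k : ℕ) : G (k+3) = (X - C (1/2)) * G (k+2) - C (gb k) * G (k+1) := by
  rw [G, gb]

lemma LL_G (n : ℕ) : LL (G (n+2)) = 0 := by
  induction n using Nat.strong_induction_on with
  | _ n ih =>
    match n, ih with
    | 0, _ =>
      have h := LL_struct 0
      have e : (X - C (1/2)) * G (0+1) = G (0+2) := by simp [G]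
      rw [e] at h
      push_cast at h
      linarith
    | k+1, ih =>
      have h := LL_struct (k+1)
      have r := congrArg LL (G_rec k)
      rw [LL_sub, LL_C] at r
      have z : (k:ℝ) * LL (G (k+1)) = 0 := by
        rcases k with _ | k
        · simp
        · rw [ih k (by omega)]; simp
      simp only [add_assoc, Nat.reduceAdd] at h ⊢
      push_cast at h
      have : ((k:ℝ)+7) * LL (G (k+3)) = 0 := by
        linear_combination (-1) * h + gb k * z - k * r
      rcases mul_eq_zero.1 this with h | h
      · exact absurd h (by positivity)
      · exact h

lemma orth (m : ℕ) : ∀ n, m < n → LL (G (m+1) * G (n+1)) = 0 := by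
  induction m using Nat.strong_induction_on with
  | _ m ih =>
    intro n hn
    obtain ⟨n, rfl⟩ : ∃ l, n = l+1 := ⟨n-1, by omega⟩
    match m, ih with
    | 0, _ => simpa [G] using LL_G n
    | 1, ih =>
      obtain ⟨n, rfl⟩ : ∃ l, n = l+1 := ⟨n-1, by omega⟩
      have e : G (1+1) * G (n+1+1+1) =
        G (0+1) * G ((n+3)+1) - C (-gb (n+1)) * (G (0+1) * G ((n+1)+1)) := by
        have := G_rec (n+1)
        simp only [add_assoc, Nat.reduceAdd] at this ⊢
        rw [this]
        simp [G]
      rw [e, LL_sub, LL_C, ih 0 (by omega) (n+3) (by omega), ih 0 (by omega) (n+1) (by omega)]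
      simp
    | m+2, ih =>
      obtain ⟨n, rfl⟩ : ∃ l, n = l+1 := ⟨n-1, by omega⟩
      have e : G (m+2+1) * G (n+1+1+1) =
        G ((m+1)+1) * G ((n+3)+1) - C (-gb (n+1)) * (G ((m+1)+1) * G ((n+1)+1))
          - C (gb m) * (G (m+1) * G ((n+2)+1)) := by
        have := G_rec (n+1)
        have h2 := G_rec m
        simp only [add_assoc, Nat.reduceAdd] at this h2 ⊢
        rw [this, h2, C_neg]
        ring
      rw [e, LL_sub, LL_sub, LL_C, LL_C, ih (m+1) (by omega) (n+3) (by omega),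
        ih (m+1) (by omega) (n+1) (by omega), ih m (by omega) (n+2) (by omega)]
      simp

/-- L²(0,1)-orthogonality of the ψ_k. -/
theorem psi_orthogonal (k j : ℕ) (hk : 1 ≤ k) (hj : 1 ≤ j) (hkj : k ≠ j) :
    (∫ x in (0:ℝ)..1, (psi k).eval x * (psi j).eval x) = 0 := by
  have h0 : LL (G k * G j) = 0 := by
    obtain ⟨k, rfl⟩ : ∃ l, k = l+1 := ⟨k-1, by omega⟩
    obtain ⟨j, rfl⟩ : ∃ l, j = l+1 := ⟨j-1, by omega⟩
    rcases lt_or_gt_of_ne hkj with h | h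
    · exact orth k j (by omega)
    · rw [mul_comm]; exact orth j k (by omega)
  set a : ℝ := ((Nat.factorial (2*k+2) : ℝ) /
      ((Nat.factorial (k-1) : ℝ) * (Nat.factorial (k+1) : ℝ))) with ha
  set b : ℝ := ((Nat.factorial (2*j+2) : ℝ) /
      ((Nat.factorial (j-1) : ℝ) * (Nat.factorial (j+1) : ℝ))) with hb
  have h1 : (∫ x in (0:ℝ)..1, (psi k).eval x * (psi j).eval x) = LL (C (a*b) * (G k * G j)) := by
    unfold LL
    congr 1; ext x
    simp only [psi, ← ha, ← hb, eval_mul, eval_C, eval_X, eval_sub, eval_one]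
    ring
  rw [h1, LL_C, h0, mul_zero]
end

section
/- Let q ≥ 1 be an integer and let φ₁*, φ₂* be as in the context. Then for every integer j with 1 ≤ j ≤ q−1 one has ⟨φ₁*, ψ_j⟩ = 0 and ⟨φ₂*, ψ_j⟩ = 0, while for every integer k ≥ q one has ⟨φ₁*, ψ_k⟩ = 1 and ⟨φ₂*, ψ_k⟩ = (−1)^{k−1}, where ⟨f,g⟩ = ∫₀¹ f(x)g(x) dx. -/
open Polynomial

/-- φ₁* = X − ∑_{k=1}^{q−1} ((2k+3)/(k(k+1)(k+2)(k+3)))·ψ_k. -/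
noncomputable def phiStar1 (q : ℕ) : Polynomial ℝ :=
  Polynomial.X - ∑ k ∈ Finset.Icc 1 (q-1),
    Polynomial.C ((2*(k:ℝ)+3)/((k:ℝ)*((k:ℝ)+1)*((k:ℝ)+2)*((k:ℝ)+3))) * psi k

/-- φ₂* = (1−X) − ∑_{k=1}^{q−1} ((−1)^{k−1}(2k+3)/(k(k+1)(k+2)(k+3)))·ψ_k. -/
noncomputable def phiStar2 (q : ℕ) : Polynomial ℝ :=
  (1 - Polynomial.X) - ∑ k ∈ Finset.Icc 1 (q-1),
    Polynomial.C ((-1:ℝ)^(k-1) * (2*(k:ℝ)+3)/((k:ℝ)*((k:ℝ)+1)*((k:ℝ)+2)*((k:ℝ)+3))) * psi k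


noncomputable def II (p : ℝ[X]) : ℝ := ∫ x in (0:ℝ)..1, p.eval x

lemma II_int (p : ℝ[X]) : IntervalIntegrable (fun x => p.eval x) MeasureTheory.volume 0 1 :=
  p.continuous.intervalIntegrable _ _

lemma II_add (p r : ℝ[X]) : II (p + r) = II p + II r := by
  simp only [II, eval_add]
  exact intervalIntegral.integral_add (II_int p) (II_int r)

lemma II_C (c : ℝ) (p : ℝ[X]) : II (C c * p) = c * II p := by
  simp only [II, eval_mul, eval_C]
  exact intervalIntegral.integral_const_mul _ _

lemma II_sub (p r : ℝ[X]) : II (p - r) = II p - II r := by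
  simp only [II, eval_sub]
  exact intervalIntegral.integral_sub (II_int p) (II_int r)

lemma II_zero : II 0 = 0 := by simp [II]

lemma II_sum (s : Finset ℕ) (f : ℕ → ℝ[X]) : II (∑ i ∈ s, f i) = ∑ i ∈ s, II (f i) := by
  classical
  induction s using Finset.induction_on with
  | empty => simp [II_zero]
  | insert a s ha ih => rw [Finset.sum_insert ha, Finset.sum_insert ha, II_add, ih]

lemma II_pow (n : ℕ) : II (X ^ n) = 1 / ((n:ℝ) + 1) := by
  simp [II, integral_pow]

noncomputable def ga (n : ℕ) : ℝ := (((n:ℝ)+1)*((n:ℝ)+5))/(4*(2*(n:ℝ)+5)*(2*(n:ℝ)+7))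

noncomputable def gg (n : ℕ) : ℝ[X] := G (n+1)

lemma gg_zero : gg 0 = 1 := by simp [gg, G]
lemma gg_one : gg 1 = (X - C (1/2)) * gg 0 := by simp [gg, G]
lemma gg_rec (n : ℕ) : gg (n+2) = (X - C (1/2)) * gg (n+1) - C (ga n) * gg n := by
  simp only [gg, ga]
  rw [G]

noncomputable def ww : ℝ[X] := X * (1 - X)

noncomputable def MM (m n : ℕ) : ℝ := II (ww^2 * X^n * gg m)

lemma MM_zero (n : ℕ) : MM 0 n = 2 / (((n:ℝ)+3)*((n:ℝ)+4)*((n:ℝ)+5)) := by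
  have : ww^2 * X^n * gg 0 = X^(n+2) - C 2 * X^(n+3) + X^(n+4) := by
    rw [gg_zero, ww, show (C 2 : ℝ[X]) = 2 from rfl]; ring
  rw [MM, this, II_add, II_sub, II_C, II_pow, II_pow, II_pow]
  push_cast
  field_simp
  ring

lemma MM_one (n : ℕ) : MM 1 n = MM 0 (n+1) - 1/2 * MM 0 n := by
  have : ww^2 * X^n * gg 1 = ww^2 * X^(n+1) * gg 0 - C (1/2) * (ww^2 * X^n * gg 0) := by
    rw [gg_one]; ring
  rw [MM, this, II_sub, II_C]; rfl

lemma MM_rec (m n : ℕ) : MM (m+2) n = MM (m+1) (n+1) - 1/2 * MM (m+1) n - ga m * MM m n := by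
  have : ww^2 * X^n * gg (m+2) = ww^2 * X^(n+1) * gg (m+1) - C (1/2) * (ww^2 * X^n * gg (m+1))
      - C (ga m) * (ww^2 * X^n * gg m) := by
    rw [gg_rec]; ring
  rw [MM, this, II_sub, II_sub, II_C, II_C]; rfl

noncomputable def FF (m n : ℕ) : ℝ :=
  (((m+4).factorial : ℝ) * ((m+2).factorial : ℝ) / ((2*m+4).factorial : ℝ)) *
    ((n.descFactorial m : ℕ) : ℝ) * ((n+2).factorial : ℝ) / ((n+m+5).factorial : ℝ)

lemma desc_succ (n m : ℕ) : ((n.descFactorial (m+1) : ℕ) : ℝ) = ((n:ℝ) - m) * (n.descFactorial m : ℕ) := by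
  rw [Nat.descFactorial_succ]
  rcases le_or_gt m n with h | h
  · push_cast [Nat.cast_sub h]; ring
  · rw [Nat.descFactorial_of_lt h]; simp

lemma FF_rec (m n : ℕ) : FF (m+2) n = FF (m+1) (n+1) - 1/2 * FF (m+1) n - ga m * FF m n := by
  have d1 := desc_succ n m
  have d2 := desc_succ n (m+1)
  have d3 : (((n+1).descFactorial (m+1) : ℕ) : ℝ) = ((n:ℝ)+1) * (n.descFactorial m : ℕ) := by
    rw [Nat.succ_descFactorial_succ]; push_cast; ring
  rw [d1] at d2
  have e1 : 2*(m+2)+4 = (2*m+4)+1+1+1+1 := by ring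
  have e2 : 2*(m+1)+4 = (2*m+4)+1+1 := by ring
  have e3 : n+(m+2)+5 = (n+m+5)+1+1 := by ring
  have e4 : n+1+(m+1)+5 = (n+m+5)+1+1 := by ring
  have e5 : n+(m+1)+5 = (n+m+5)+1 := by ring
  have e6 : m+2+4 = (m+4)+1+1 := by ring
  have e7 : m+1+4 = (m+4)+1 := by ring
  have e8 : m+2+2 = (m+2)+1+1 := by ring
  have e9 : m+1+2 = (m+2)+1 := by ring
  have e10 : n+1+2 = (n+2)+1 := by ring
  simp only [FF, ga]
  rw [show m+2 = m+1+1 from rfl] at *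
  rw [d2, d1, d3]
  simp only [e1, e2, e3, e4, e5, e6, e7, e8, e9, e10, show m+1+1+2 = (m+2)+1+1 from rfl] at *
  rw [show m+1+1 = m+2 from rfl] at *
  simp only [Nat.factorial_succ (2*m+4+1+1+1),
    Nat.factorial_succ (2*m+4+1+1), Nat.factorial_succ (2*m+4+1), Nat.factorial_succ (2*m+4),
    Nat.factorial_succ (n+m+5+1), Nat.factorial_succ (n+m+5), Nat.factorial_succ (m+4+1),
    Nat.factorial_succ (m+4), Nat.factorial_succ (m+2+1), Nat.factorial_succ (m+2),
    Nat.factorial_succ (n+2)]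
  have p1 : ((2*m+4).factorial : ℝ) ≠ 0 := by positivity
  have p2 : ((n+m+5).factorial : ℝ) ≠ 0 := by positivity
  generalize ((2*m+4).factorial) = A at *
  generalize ((n+m+5).factorial) = B at *
  generalize ((m+4).factorial) = A1 at *
  generalize ((m+2).factorial) = A2 at *
  generalize ((n+2).factorial) = A3 at *
  generalize (n.descFactorial m) = A4 at *
  clear d1 d2 d3
  push_cast
  have q1 : (2*(m:ℝ)+4+1+1+1+1) ≠ 0 := by positivity
  have q2 : (2*(m:ℝ)+4+1+1+1) ≠ 0 := by positivity
  have q3 : (2*(m:ℝ)+4+1+1) ≠ 0 := by positivity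
  have q4 : (2*(m:ℝ)+4+1) ≠ 0 := by positivity
  have q5 : ((n:ℝ)+m+5+1+1) ≠ 0 := by positivity
  have q6 : ((n:ℝ)+m+5+1) ≠ 0 := by positivity
  have q7 : (2*(m:ℝ)+5) ≠ 0 := by positivity
  have q8 : (2*(m:ℝ)+7) ≠ 0 := by positivity
  field_simp
  ring

lemma FF_zero (n : ℕ) : FF 0 n = 2 / (((n:ℝ)+3)*((n:ℝ)+4)*((n:ℝ)+5)) := by
  simp only [FF]
  rw [show n+0+5 = (n+2)+1+1+1 by ring]
  simp only [Nat.factorial_succ (n+2+1+1), Nat.factorial_succ (n+2+1), Nat.factorial_succ (n+2)]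
  have p1 : ((n+2).factorial : ℝ) ≠ 0 := by positivity
  generalize (n+2).factorial = A at *
  norm_num [Nat.factorial]
  field_simp
  ring

lemma FF_one (n : ℕ) : FF 1 n = FF 0 (n+1) - 1/2 * FF 0 n := by
  rw [FF_zero, FF_zero]
  simp only [FF]
  rw [show n+1+5 = (n+2)+1+1+1+1 by ring]
  simp only [Nat.factorial_succ (n+2+1+1+1), Nat.factorial_succ (n+2+1+1), Nat.factorial_succ (n+2+1), Nat.factorial_succ (n+2)]
  have p1 : ((n+2).factorial : ℝ) ≠ 0 := by positivity
  generalize (n+2).factorial = A at *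
  norm_num [Nat.factorial]
  field_simp
  ring

lemma MM_eq (m : ℕ) : (∀ n, MM m n = FF m n) ∧ (∀ n, MM (m+1) n = FF (m+1) n) := by
  induction m with
  | zero =>
    have h : ∀ n, MM 0 n = FF 0 n := fun n => by rw [MM_zero, FF_zero]
    exact ⟨h, fun n => by rw [MM_one, FF_one, h, h]⟩
  | succ m ih =>
    exact ⟨ih.2, fun n => by rw [MM_rec, FF_rec, ih.1, ih.2, ih.2]⟩

noncomputable def hh : ℕ → ℝ
  | 0 => 1/30
  | n+1 => ga n * hh n

noncomputable def EE (i j : ℕ) : ℝ := II (ww^2 * gg i * gg j)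

lemma EE_zero (j : ℕ) : EE 0 j = if 0 = j then hh 0 else 0 := by
  have : EE 0 j = MM j 0 := by simp [EE, MM, gg_zero]
  rw [this, (MM_eq j).1]
  rcases j with _ | j
  · rw [FF_zero]; norm_num [hh]
  · simp [FF]

lemma EE_one_zero (i : ℕ) : II (ww^2 * ((X - C (1/2)) * gg i) * gg 0) = EE i 1 := by
  rw [EE, gg_one]; congr 1; ring

lemma EE_shift (i j : ℕ) : II (ww^2 * ((X - C (1/2)) * gg i) * gg (j+1)) =
    EE i (j+2) + ga j * EE i j := by
  rw [EE, EE, ← II_C, ← II_add, gg_rec]; congr 1; ring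

lemma EE_one (j : ℕ) : EE 1 j = II (ww^2 * ((X - C (1/2)) * gg 0) * gg j) := by
  rw [EE, gg_one]

lemma EE_rec (i j : ℕ) : EE (i+2) j =
    II (ww^2 * ((X - C (1/2)) * gg (i+1)) * gg j) - ga i * EE i j := by
  rw [EE, EE, ← II_C, ← II_sub, gg_rec]; congr 1; ring

lemma EE_eq (i : ℕ) : (∀ j, EE i j = if i = j then hh i else 0) ∧
    (∀ j, EE (i+1) j = if i+1 = j then hh (i+1) else 0) := by
  induction i with
  | zero =>
    refine ⟨EE_zero, fun j => ?_⟩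
    rw [EE_one]
    rcases j with _ | j
    · rw [EE_one_zero, EE_zero]; simp
    · rw [EE_shift, EE_zero, EE_zero]
      rcases j with _ | j
      · simp [hh]
      · simp
  | succ i ih =>
    refine ⟨ih.2, fun j => ?_⟩
    rw [show i+1+1 = i+2 from rfl, EE_rec, ih.1]
    rcases j with _ | j
    · rw [EE_one_zero, ih.2]
      rcases i with _ | i
      · simp [hh]
      · simp
    · rw [EE_shift, ih.2, ih.2]
      by_cases h1 : i = j + 1
      · subst h1; simp [hh]; omega
      · by_cases h2 : i + 1 = j
        · subst h2; simp [hh]; omega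
        · have h3 : ¬ (i+1 = j+2) := by omega
          have h4 : ¬ (i+2 = j+1) := by omega
          simp [h1, h2, h3, h4]

noncomputable def cc (n : ℕ) : ℝ := ((2*n+4).factorial : ℝ) / ((n.factorial : ℝ) * ((n+2).factorial : ℝ))

lemma cc_pos (n : ℕ) : 0 < cc n := by unfold cc; positivity

lemma cc_succ (n : ℕ) : cc (n+1) = 2 * (2*(n:ℝ)+5) / ((n:ℝ)+1) * cc n := by
  simp only [cc]
  rw [show 2*(n+1)+4 = (2*n+4)+1+1 by ring, show n+1+2 = (n+2)+1 by ring]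
  simp only [Nat.factorial_succ (2*n+4+1), Nat.factorial_succ (2*n+4), Nat.factorial_succ n,
    Nat.factorial_succ (n+2)]
  have p1 : ((n+2).factorial : ℝ) ≠ 0 := by positivity
  have p2 : (n.factorial : ℝ) ≠ 0 := by positivity
  generalize (n+2).factorial = A at *
  generalize n.factorial = B at *
  generalize (2*n+4).factorial = D at *
  push_cast
  have q1 : (n:ℝ)+2+1 ≠ 0 := by positivity
  field_simp
  ring

lemma cc_zero : cc 0 = 12 := by norm_num [cc, Nat.factorial]

lemma psi_eq (n : ℕ) : psi (n+1) = C (cc n) * (ww * gg n) := by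
  simp only [psi, cc, ww, gg]
  rw [show 2*(n+1)+2 = 2*n+4 by ring, show n+1-1 = n by omega, show n+1+1 = n+2 from rfl]
  ring

lemma hh_cc (n : ℕ) : cc n ^ 2 * hh n = ((n:ℝ)+1)*(n+2)*(n+3)*(n+4)/(2*n+5) := by
  induction n with
  | zero => norm_num [cc_zero, hh]
  | succ n ih =>
    have : cc (n+1)^2 * hh (n+1) = (2 * (2*(n:ℝ)+5) / ((n:ℝ)+1))^2 * ga n * (cc n ^ 2 * hh n) := by
      rw [cc_succ, hh]; ring
    rw [this, ih, ga]
    push_cast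
    have : 2*((n:ℝ)+1)+5 ≠ 0 := by positivity
    field_simp
    ring

lemma psi_psi (m n : ℕ) : II (psi (m+1) * psi (n+1)) =
    if m = n then ((n:ℝ)+1)*(n+2)*(n+3)*(n+4)/(2*n+5) else 0 := by
  have : psi (m+1) * psi (n+1) = C (cc m) * (C (cc n) * (ww^2 * gg m * gg n)) := by
    rw [psi_eq, psi_eq]; ring
  rw [this, II_C, II_C]
  have h := (EE_eq m).1 n
  rw [EE] at h
  rw [h]
  split_ifs with h
  · subst h; rw [← hh_cc]; ring
  · simp

lemma EE0_succ (n : ℕ) : II (ww^2 * gg (n+1)) = 0 := by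
  have h := EE_zero (n+1)
  rw [EE, gg_zero] at h
  simpa using h

lemma EE0_zero : II (ww^2 * gg 0) = 1/30 := by
  have h := EE_zero 0
  rw [EE, gg_zero] at h
  simpa [gg_zero, hh] using h

noncomputable def aa (n : ℕ) : ℝ := II (X * ww * gg n)
noncomputable def bb (n : ℕ) : ℝ := II ((1 - X) * ww * gg n)

lemma CC2 : (C (1/2) : ℝ[X]) = 1 - C (1/2) := by
  rw [← C_1, ← C_sub]; norm_num

lemma aa_zero : aa 0 = 1/12 := by
  have : X * ww * gg 0 = X^2 - X^3 := by rw [gg_zero, ww]; ring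
  rw [aa, this, II_sub, II_pow, II_pow]; norm_num

lemma bb_zero : bb 0 = 1/12 := by
  have : (1-X) * ww * gg 0 = X^1 - C 2 * X^2 + X^3 := by
    rw [gg_zero, ww, show (C 2 : ℝ[X]) = 2 from rfl]; ring
  rw [bb, this, II_add, II_sub, II_C, II_pow, II_pow, II_pow]; norm_num

lemma aa_step (p : ℝ[X]) : II (X * ww * ((X - C (1/2)) * p)) = 1/2 * II (X * ww * p) - II (ww^2 * p) := by
  rw [← II_C, ← II_sub]; congr 1
  have : X * ww * ((X - C (1/2)) * p) - (C (1/2) * (X * ww * p) - ww^2 * p) =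
     X * ww * p * ((1 - C (1/2)) - C (1/2)) := by rw [ww]; ring
  rw [← CC2, sub_self, mul_zero] at this
  exact sub_eq_zero.mp this

lemma bb_step (p : ℝ[X]) : II ((1-X) * ww * ((X - C (1/2)) * p)) = II (ww^2 * p) - 1/2 * II ((1-X) * ww * p) := by
  rw [← II_C, ← II_sub]; congr 1
  rw [ww]; ring

lemma aa_one : aa 1 = 1/120 := by
  have h := aa_zero
  rw [aa] at h ⊢
  rw [gg_one, aa_step, h, EE0_zero]; norm_num

lemma bb_one : bb 1 = -1/120 := by
  have h := bb_zero
  rw [bb] at h ⊢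
  rw [gg_one, bb_step, h, EE0_zero]; norm_num

lemma aa_rec (n : ℕ) : aa (n+2) = 1/2 * aa (n+1) - ga n * aa n := by
  have : X * ww * gg (n+2) = X * ww * ((X - C (1/2)) * gg (n+1)) - C (ga n) * (X * ww * gg n) := by
    rw [gg_rec]; ring
  rw [aa, this, II_sub, II_C, aa_step, EE0_succ, aa, aa]; ring

lemma bb_rec (n : ℕ) : bb (n+2) = -1/2 * bb (n+1) - ga n * bb n := by
  have : (1-X) * ww * gg (n+2) = (1-X) * ww * ((X - C (1/2)) * gg (n+1))
      - C (ga n) * ((1-X) * ww * gg n) := by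
    rw [gg_rec]; ring
  rw [bb, this, II_sub, II_C, bb_step, EE0_succ, bb, bb]; ring

lemma cc_one : cc 1 = 120 := by norm_num [cc, Nat.factorial]

lemma cc_rec (n : ℕ) : 1 / cc (n+2) = 1/2 * (1 / cc (n+1)) - ga n * (1 / cc n) := by
  rw [show n+2 = (n+1)+1 from rfl, cc_succ (n+1), cc_succ n, ga]
  have := (cc_pos n).ne'
  generalize cc n = c at *
  push_cast
  have : 2*((n:ℝ)+1)+5 ≠ 0 := by positivity
  field_simp
  ring

lemma aa_eq (n : ℕ) : aa n = 1 / cc n ∧ aa (n+1) = 1 / cc (n+1) := by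
  induction n with
  | zero => exact ⟨by rw [aa_zero, cc_zero], by rw [aa_one, cc_one]⟩
  | succ n ih => exact ⟨ih.2, by rw [aa_rec, ih.1, ih.2, cc_rec]⟩

lemma bb_eq (n : ℕ) : bb n = (-1)^n * (1 / cc n) ∧ bb (n+1) = (-1)^(n+1) * (1 / cc (n+1)) := by
  induction n with
  | zero => exact ⟨by rw [bb_zero, cc_zero]; norm_num, by rw [bb_one, cc_one]; norm_num⟩
  | succ n ih => exact ⟨ih.2, by rw [bb_rec, ih.1, ih.2, show n+1+1 = n+2 from rfl, cc_rec]; ring⟩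

lemma X_psi (n : ℕ) : II (X * psi (n+1)) = 1 := by
  have : X * psi (n+1) = C (cc n) * (X * ww * gg n) := by rw [psi_eq]; ring
  have h := (aa_eq n).1
  rw [aa] at h
  rw [this, II_C, h]
  have := (cc_pos n).ne'
  field_simp

lemma X_psi' (n : ℕ) : II ((1-X) * psi (n+1)) = (-1)^n := by
  have : (1-X) * psi (n+1) = C (cc n) * ((1-X) * ww * gg n) := by rw [psi_eq]; ring
  have h := (bb_eq n).1
  rw [bb] at h
  rw [this, II_C, h]
  have := (cc_pos n).ne'
  field_simp

lemma sum_psi (q n : ℕ) (f : ℕ → ℝ) : II ((∑ k ∈ Finset.Icc 1 (q-1), C (f k) * psi k) * psi (n+1)) =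
    if n + 1 ≤ q - 1 then f (n+1) * (((n:ℝ)+1)*(n+2)*(n+3)*(n+4)/(2*n+5)) else 0 := by
  rw [Finset.sum_mul, II_sum]
  have : ∀ k ∈ Finset.Icc 1 (q-1), II (C (f k) * psi k * psi (n+1)) =
      if k = n+1 then f (n+1) * (((n:ℝ)+1)*(n+2)*(n+3)*(n+4)/(2*n+5)) else 0 := by
    intro k hk
    obtain ⟨m, rfl⟩ : ∃ m, k = m+1 := ⟨k-1, by have := (Finset.mem_Icc.mp hk).1; omega⟩
    rw [mul_assoc, II_C, psi_psi]
    by_cases h : m = n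
    · subst h; simp
    · simp [h]
  rw [Finset.sum_congr rfl this, Finset.sum_ite_eq']
  simp

lemma main1 (q n : ℕ) : (∫ x in (0:ℝ)..1, (phiStar1 q).eval x * (psi (n+1)).eval x) =
    if n + 1 ≤ q - 1 then 0 else 1 := by
  have : (∫ x in (0:ℝ)..1, (phiStar1 q).eval x * (psi (n+1)).eval x) = II (phiStar1 q * psi (n+1)) := by
    simp only [II, eval_mul]
  rw [this, phiStar1, sub_mul, II_sub, X_psi,
    sum_psi q n (fun k => (2*(k:ℝ)+3)/((k:ℝ)*((k:ℝ)+1)*((k:ℝ)+2)*((k:ℝ)+3)))]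
  split_ifs
  · push_cast
    have : 2*((n:ℝ)+1)+3 ≠ 0 := by positivity
    have : (n:ℝ)+1+1 ≠ 0 := by positivity
    have : (n:ℝ)+1+2 ≠ 0 := by positivity
    have : (n:ℝ)+1+3 ≠ 0 := by positivity
    field_simp
    ring
  · simp

lemma main2 (q n : ℕ) : (∫ x in (0:ℝ)..1, (phiStar2 q).eval x * (psi (n+1)).eval x) =
    if n + 1 ≤ q - 1 then 0 else (-1)^n := by
  have : (∫ x in (0:ℝ)..1, (phiStar2 q).eval x * (psi (n+1)).eval x) = II (phiStar2 q * psi (n+1)) := by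
    simp only [II, eval_mul]
  rw [this, phiStar2, sub_mul, II_sub, X_psi',
    sum_psi q n (fun k => (-1:ℝ)^(k-1) * (2*(k:ℝ)+3)/((k:ℝ)*((k:ℝ)+1)*((k:ℝ)+2)*((k:ℝ)+3)))]
  split_ifs
  · rw [show n+1-1 = n by omega]
    generalize (-1:ℝ)^n = s
    push_cast
    have : 2*((n:ℝ)+1)+3 ≠ 0 := by positivity
    have : (n:ℝ)+1+1 ≠ 0 := by positivity
    have : (n:ℝ)+1+2 ≠ 0 := by positivity
    have : (n:ℝ)+1+3 ≠ 0 := by positivity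
    field_simp
    ring
  · simp

/-- Inner products of φ₁*, φ₂* with the ψ's. -/
theorem phiStar_psi_inner (q : ℕ) (hq : 1 ≤ q) :
    (∀ j : ℕ, 1 ≤ j → j ≤ q - 1 →
        (∫ x in (0:ℝ)..1, (phiStar1 q).eval x * (psi j).eval x) = 0 ∧
        (∫ x in (0:ℝ)..1, (phiStar2 q).eval x * (psi j).eval x) = 0) ∧
    (∀ k : ℕ, q ≤ k →
        (∫ x in (0:ℝ)..1, (phiStar1 q).eval x * (psi k).eval x) = 1 ∧
        (∫ x in (0:ℝ)..1, (phiStar2 q).eval x * (psi k).eval x) = (-1:ℝ)^(k-1)) := by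
  refine ⟨fun j h1 h2 => ?_, fun k hk => ?_⟩
  · obtain ⟨n, rfl⟩ : ∃ n, j = n+1 := ⟨j-1, by omega⟩
    rw [main1, main2, if_pos h2, if_pos h2]
    exact ⟨rfl, rfl⟩
  · obtain ⟨n, rfl⟩ : ∃ n, k = n+1 := ⟨k-1, by omega⟩
    have h : ¬ (n + 1 ≤ q - 1) := by omega
    rw [main1, main2, if_neg h, if_neg h]
    exact ⟨rfl, by simp⟩
end
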